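/- arXiv:1911.12899 — 6 statements merged into one kernel-verified Lean document; each statement's English description precedes it below -/
import Mathlib

section
/- Let H be a real inner product space, m ≥ 1, Δ ≥ 0 a real number, and let d, p : Fin m → H be two model configurations with averages d̄ = (1/m)∑_{i} d i and p̄ = (1/m)∑_{i} p i. If the divergence of d satisfies (1/m)∑_{i} ‖d i − d̄‖² ≤ Δ, then ∑_{i} ‖d i − p̄‖² ≤ ∑_{i} ‖d i − p i‖² + m·Δ. -/
theorem aux_var {H : Type*} [NormedAddCommGroup H] [InnerProductSpace ℝ H] (m : ℕ)
    (x : Fin m → H) (a c : H) (ha : ∑ i, x i = (m : ℝ) • a) :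
    ∑ i, ‖x i - c‖ ^ 2 = ∑ i, ‖x i - a‖ ^ 2 + (m : ℝ) * ‖a - c‖ ^ 2 := by
  have h : ∀ i, ‖x i - c‖ ^ 2 = ‖x i - a‖ ^ 2 + 2 * inner ℝ (x i - a) (a - c) + ‖a - c‖ ^ 2 := by
    intro i
    rw [← norm_add_sq_real, sub_add_sub_cancel]
  have h0 : ∑ i, (x i - a) = 0 := by
    rw [Finset.sum_sub_distrib, ha]
    simp [Nat.cast_smul_eq_nsmul]
  simp only [h, Finset.sum_add_distrib, ← Finset.mul_sum, ← sum_inner, h0]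
  simp

/-- If the divergence of `d` is at most `Δ`, then replacing `p` by its average `p̄`
increases the sum of squared distances to the `d i` by at most `m·Δ`:
`∑ i, ‖d i − p̄‖² ≤ ∑ i, ‖d i − p i‖² + m·Δ`. -/
theorem sum_sq_dist_to_avg_le {H : Type*} [NormedAddCommGroup H]
    [InnerProductSpace ℝ H] (m : ℕ) (hm : 1 ≤ m) (Δ : ℝ) (hΔ : 0 ≤ Δ)
    (d p : Fin m → H)
    (hdiv : (m : ℝ)⁻¹ * ∑ i : Fin m, ‖d i - ((m : ℝ)⁻¹ • ∑ j : Fin m, d j)‖ ^ 2 ≤ Δ) :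
    ∑ i : Fin m, ‖d i - ((m : ℝ)⁻¹ • ∑ j : Fin m, p j)‖ ^ 2 ≤
      (∑ i : Fin m, ‖d i - p i‖ ^ 2) + (m : ℝ) * Δ := by
  have hm0 : (m : ℝ) ≠ 0 := by positivity
  have hmp : (0 : ℝ) < m := by positivity
  have h1 := aux_var m d ((m : ℝ)⁻¹ • ∑ j, d j) ((m : ℝ)⁻¹ • ∑ j, p j)
    (by rw [smul_inv_smul₀ hm0])
  have h2 := aux_var m (fun i => d i - p i)
    ((m : ℝ)⁻¹ • ∑ j, d j - (m : ℝ)⁻¹ • ∑ j, p j) 0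
    (by rw [← smul_sub, smul_inv_smul₀ hm0, Finset.sum_sub_distrib])
  simp only [sub_zero] at h2
  have h3 : 0 ≤ ∑ i, ‖d i - p i - ((m : ℝ)⁻¹ • ∑ j, d j - (m : ℝ)⁻¹ • ∑ j, p j)‖ ^ 2 :=
    Finset.sum_nonneg fun i _ => by positivity
  rw [inv_mul_le_iff₀ hmp] at hdiv
  linarith
end

section
/- Let H be a real inner product space, m ≥ 1, T ≥ 1, γ > 0, Δ ≥ 0, ε ≥ 0. Let D, P : ℕ → Fin m → H be two sequences of model configurations and ℓ : ℕ → H → ℝ a family of loss functionals. Assume D 1 = P 1 and that for every t with 1 ≤ t ≤ T, ∑_{i} ‖D (t+1) i − P (t+1) i‖² ≤ ∑_{i} ‖D t i − P t i‖² − γ²·∑_{i} (ℓ t (D t i) − ℓ t (P t i))² + Δ + 2ε². Then the cumulative losses satisfy ∑_{t=1}^{T} ∑_{i} ℓ t (D t i) ≤ ∑_{t=1}^{T} ∑_{i} ℓ t (P t i) + (T/γ)·√(m·(Δ + 2ε²)). -/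
/-- Cumulative-loss comparison of Theorem 1: under the per-step contraction, the
cumulative loss of the dynamic protocol exceeds that of the periodic protocol by at
most `(T/γ)·√(m·(Δ + 2ε²))`. -/
theorem cumulative_loss_comparison {H : Type*} [NormedAddCommGroup H]
    [InnerProductSpace ℝ H] (m T : ℕ) (hm : 1 ≤ m) (hT : 1 ≤ T)
    (γ Δ ε : ℝ) (hγ : 0 < γ) (hΔ : 0 ≤ Δ) (hε : 0 ≤ ε)
    (D P : ℕ → Fin m → H) (ℓ : ℕ → H → ℝ)
    (hinit : D 1 = P 1)
    (hstep : ∀ t, 1 ≤ t → t ≤ T →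
      ∑ i : Fin m, ‖D (t + 1) i - P (t + 1) i‖ ^ 2 ≤
        (∑ i : Fin m, ‖D t i - P t i‖ ^ 2)
          - γ ^ 2 * (∑ i : Fin m, (ℓ t (D t i) - ℓ t (P t i)) ^ 2)
          + Δ + 2 * ε ^ 2) :
    ∑ t ∈ Finset.Icc 1 T, ∑ i : Fin m, ℓ t (D t i) ≤
      (∑ t ∈ Finset.Icc 1 T, ∑ i : Fin m, ℓ t (P t i))
        + ((T : ℝ) / γ) * Real.sqrt ((m : ℝ) * (Δ + 2 * ε ^ 2)) := by
  have key : ∀ k, k ≤ T → ∑ i : Fin m, ‖D (k + 1) i - P (k + 1) i‖ ^ 2 +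
      γ ^ 2 * ∑ t ∈ Finset.Icc 1 k, ∑ i : Fin m, (ℓ t (D t i) - ℓ t (P t i)) ^ 2
        ≤ (k : ℝ) * (Δ + 2 * ε ^ 2) := by
    intro k
    induction k with
    | zero => intro _; simp [hinit]
    | succ k ih =>
      intro hk
      have h1 := ih (by omega)
      have h2 := hstep (k + 1) (by omega) hk
      rw [Finset.sum_Icc_succ_top (by omega)]
      push_cast
      linarith
  have hS := key T le_rfl
  have h0 : 0 ≤ ∑ i : Fin m, ‖D (T + 1) i - P (T + 1) i‖ ^ 2 :=
    Finset.sum_nonneg fun i _ => by positivity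
  have cs : (∑ t ∈ Finset.Icc 1 T, ∑ i : Fin m, (ℓ t (D t i) - ℓ t (P t i))) ^ 2 ≤
      (T : ℝ) * (m * ∑ t ∈ Finset.Icc 1 T, ∑ i : Fin m, (ℓ t (D t i) - ℓ t (P t i)) ^ 2) := by
    refine (sq_sum_le_card_mul_sum_sq).trans ?_
    rw [Nat.card_Icc, Nat.add_sub_cancel, Finset.mul_sum (a := (m : ℝ))]
    refine mul_le_mul_of_nonneg_left (Finset.sum_le_sum fun t _ => ?_) (Nat.cast_nonneg _)
    refine (sq_sum_le_card_mul_sum_sq).trans ?_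
    simp
  have hd : ∑ t ∈ Finset.Icc 1 T, ∑ i : Fin m, (ℓ t (D t i) - ℓ t (P t i)) =
      ∑ t ∈ Finset.Icc 1 T, ∑ i : Fin m, ℓ t (D t i) -
        ∑ t ∈ Finset.Icc 1 T, ∑ i : Fin m, ℓ t (P t i) := by
    simp only [Finset.sum_sub_distrib]
  generalize ∑ t ∈ Finset.Icc 1 T, ∑ i : Fin m, (ℓ t (D t i) - ℓ t (P t i)) ^ 2 = S at *
  generalize ∑ t ∈ Finset.Icc 1 T, ∑ i : Fin m, (ℓ t (D t i) - ℓ t (P t i)) = X at *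
  have hX : X ≤ ((T : ℝ) / γ) * Real.sqrt ((m : ℝ) * (Δ + 2 * ε ^ 2)) := by
    refine abs_le_of_sq_le_sq' ?_ (by positivity) |>.2
    rw [mul_pow, Real.sq_sqrt (by positivity), div_pow, div_mul_eq_mul_div,
      le_div_iff₀ (by positivity)]
    have h3 : γ ^ 2 * S ≤ T * (Δ + 2 * ε ^ 2) := by linarith
    have h4 := mul_le_mul_of_nonneg_left h3 (by positivity : (0 : ℝ) ≤ T * m)
    have h5 := mul_le_mul_of_nonneg_right cs (by positivity : (0 : ℝ) ≤ γ ^ 2)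
    linarith
  linarith
end

section
/- Let H be a real normed space, x : ℕ → H a sequence, c > 0 a real number, T ∈ ℕ, and V ∈ ℕ. Suppose s : Fin (V+1) → ℕ is a strictly increasing sequence of time points with s V ≤ T such that ‖x (s (k+1)) − x (s k)‖ > c for every k < V. Then c·V ≤ ∑_{t=0}^{T−1} ‖x (t+1) − x t‖, i.e., V ≤ (1/c)·∑_{t=0}^{T−1} ‖x (t+1) − x t‖. -/
/-- Excursion counting: if `s` enumerates `V + 1` strictly increasing time points in
`[0, T]` such that the model drifts by more than `c` between consecutive ones, then
`c·V` is at most the total drift `∑_{t<T} ‖x (t+1) − x t‖`. -/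
theorem violations_le_total_drift {H : Type*} [NormedAddCommGroup H]
    [NormedSpace ℝ H] (x : ℕ → H) (c : ℝ) (hc : 0 < c) (T V : ℕ)
    (s : Fin (V + 1) → ℕ) (hs : StrictMono s) (hsT : s (Fin.last V) ≤ T)
    (hviol : ∀ k : Fin V, c < ‖x (s k.succ) - x (s k.castSucc)‖) :
    c * (V : ℝ) ≤ ∑ t ∈ Finset.range T, ‖x (t + 1) - x t‖ := by
  have key : ∀ k : Fin (V + 1),
      c * ((k : ℕ) : ℝ) ≤ ∑ t ∈ Finset.range (s k), ‖x (t + 1) - x t‖ := by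
    intro k
    induction k using Fin.induction with
    | zero =>
      simp only [Fin.val_zero, Nat.cast_zero, mul_zero]
      exact Finset.sum_nonneg fun _ _ => norm_nonneg _
    | succ k ih =>
      have hle : s k.castSucc ≤ s k.succ := hs.monotone k.castSucc_lt_succ.le
      have h1 := dist_le_Ico_sum_dist x hle
      have h2 := hviol k
      simp only [dist_eq_norm'] at h1
      rw [← Finset.sum_range_add_sum_Ico _ hle]
      simp only [Fin.val_succ, Fin.val_castSucc] at ih ⊢
      push_cast
      linarith
  have h := key (Fin.last V)
  rw [Fin.val_last] at h
  exact h.trans (Finset.sum_le_sum_of_subset_of_nonneg (Finset.range_mono hsT)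
    fun _ _ _ => norm_nonneg _)
end

section
/- Let H be a real normed space, m ≥ 1, η ≥ 0, Δ > 0, T ∈ ℕ. For each learner i ∈ Fin m let f_i : ℕ → H be its model sequence and ℓ_i : ℕ → ℝ its nonnegative instantaneous losses, and assume the drift bound ‖f_i (t+1) − f_i t‖ ≤ η·ℓ_i t for all t < T. Suppose for each i there is a strictly increasing sequence of violation times s_i : Fin (V_i + 1) → ℕ with s_i V_i ≤ T and ‖f_i (s_i (k+1)) − f_i (s_i k)‖ > √Δ for all k < V_i. Then the total number of violations satisfies ∑_{i} V_i ≤ (η/√Δ)·∑_{t=0}^{T−1} ∑_{i} ℓ_i t. -/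
/-- Proposition 2: if each learner's drift per step is bounded by `η` times its
instantaneous loss and learner `i` has `V i` violations (drifts of more than `√Δ`
between consecutive violation times in `[0, T]`), then the total number of
violations is at most `(η/√Δ)` times the cumulative loss. -/
theorem number_of_violations_le {H : Type*} [NormedAddCommGroup H]
    [NormedSpace ℝ H] (m : ℕ) (hm : 1 ≤ m) (η Δ : ℝ) (hη : 0 ≤ η) (hΔ : 0 < Δ)
    (T : ℕ) (f : Fin m → ℕ → H) (ℓ : Fin m → ℕ → ℝ)
    (hℓ : ∀ i t, 0 ≤ ℓ i t)
    (hdrift : ∀ i : Fin m, ∀ t < T, ‖f i (t + 1) - f i t‖ ≤ η * ℓ i t)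
    (V : Fin m → ℕ) (s : ∀ i : Fin m, Fin (V i + 1) → ℕ)
    (hs : ∀ i, StrictMono (s i)) (hsT : ∀ i, s i (Fin.last (V i)) ≤ T)
    (hviol : ∀ i : Fin m, ∀ k : Fin (V i),
      Real.sqrt Δ < ‖f i (s i k.succ) - f i (s i k.castSucc)‖) :
    (∑ i : Fin m, (V i : ℝ)) ≤
      (η / Real.sqrt Δ) * ∑ t ∈ Finset.range T, ∑ i : Fin m, ℓ i t := by
  have hΔ' : 0 < Real.sqrt Δ := Real.sqrt_pos.mpr hΔ
  have key : ∀ i : Fin m, ∀ a b : ℕ, a ≤ b → b ≤ T →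
      ‖f i b - f i a‖ ≤ ∑ t ∈ Finset.range b, η * ℓ i t - ∑ t ∈ Finset.range a, η * ℓ i t := by
    intro i a b hab
    induction b, hab using Nat.le_induction with
    | base => intro _; simp
    | succ n hn ih =>
      intro hT
      have h1 := ih (by omega)
      have h2 := hdrift i n (by omega)
      have h3 := norm_sub_le_norm_sub_add_norm_sub (f i (n + 1)) (f i n) (f i a)
      rw [Finset.sum_range_succ]
      linarith
  have main : ∀ i : Fin m, (V i : ℝ) * Real.sqrt Δ ≤ ∑ t ∈ Finset.range T, η * ℓ i t := by
    intro i
    have hn : ∀ t, 0 ≤ η * ℓ i t := fun t => mul_nonneg hη (hℓ i t)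
    have hind : ∀ k : Fin (V i + 1),
        ((k : ℕ) : ℝ) * Real.sqrt Δ ≤ ∑ t ∈ Finset.range (s i k), η * ℓ i t := by
      intro k
      induction k using Fin.induction with
      | zero => simpa using Finset.sum_nonneg (fun t _ => hn t)
      | succ k ih =>
        have h1 := key i (s i k.castSucc) (s i k.succ)
          ((hs i).monotone (Fin.castSucc_lt_succ).le)
          (((hs i).monotone (Fin.le_last _)).trans (hsT i))
        have h2 := hviol i k
        simp only [Fin.val_succ, Fin.val_castSucc] at ih ⊢
        push_cast
        linarith
    have h := hind (Fin.last (V i))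
    rw [Fin.val_last] at h
    exact h.trans (Finset.sum_le_sum_of_subset_of_nonneg
      (Finset.range_mono (hsT i)) (fun t _ _ => hn t))
  rw [div_mul_eq_mul_div, le_div_iff₀ hΔ', Finset.sum_mul, Finset.sum_comm, Finset.mul_sum]
  refine Finset.sum_le_sum (fun i _ => ?_)
  rw [Finset.mul_sum]
  exact main i
end

section
/- Let X be a type with decidable equality, m ≥ 1, T ≥ 1, and let S : ℕ → Fin m → Finset X and N : ℕ → Fin m → Finset X satisfy: S 0 i = ∅ for all i; for all t ≥ 1 and all i, S t i = (⋃_{j} S (t−1) j) ∪ N t i, with |N t i| ≤ 1, N t i disjoint from ⋃_{j} S (t−1) j, and N t i pairwise disjoint across i. Write S̄ t = ⋃_{j} S t j. Then ∑_{t=1}^{T} ∑_{i} ( |N t i| + |S̄ t \ S t i| ) ≤ m·|S̄ T|. -/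
/-- Support vector counting for the continuous protocol: with at most one new
support vector per learner per round, disjoint from previous support vectors and
pairwise disjoint across learners, the total number of support vectors transmitted
(new vectors plus vectors missing at each learner after averaging) is at most
`m·|S̄ T|`. -/
theorem continuous_protocol_sv_count {X : Type*} [DecidableEq X]
    (m T : ℕ) (hm : 1 ≤ m) (hT : 1 ≤ T)
    (S N : ℕ → Fin m → Finset X)
    (hS0 : ∀ i : Fin m, S 0 i = ∅)
    (hstep : ∀ t, 1 ≤ t → ∀ i : Fin m,
      S t i = (Finset.univ.biUnion (S (t - 1))) ∪ N t i)
    (hNcard : ∀ t, 1 ≤ t → ∀ i : Fin m, (N t i).card ≤ 1)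
    (hNold : ∀ t, 1 ≤ t → ∀ i : Fin m,
      Disjoint (N t i) (Finset.univ.biUnion (S (t - 1))))
    (hNpair : ∀ t, 1 ≤ t → ∀ i j : Fin m, i ≠ j → Disjoint (N t i) (N t j)) :
    ∑ t ∈ Finset.Icc 1 T, ∑ i : Fin m,
        ((N t i).card + ((Finset.univ.biUnion (S t)) \ S t i).card) ≤
      m * (Finset.univ.biUnion (S T)).card := by
  clear hT
  induction T with
  | zero => simp
  | succ T ih =>
    rw [Finset.sum_Icc_succ_top (by omega)]
    have key : ∀ i : Fin m, (N (T+1) i).card +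
        ((Finset.univ.biUnion (S (T+1))) \ S (T+1) i).card +
        (Finset.univ.biUnion (S T)).card = (Finset.univ.biUnion (S (T+1))).card := by
      intro i
      have h1 : S (T+1) i ⊆ Finset.univ.biUnion (S (T+1)) :=
        Finset.subset_biUnion_of_mem (S (T+1)) (Finset.mem_univ i)
      have h2 := Finset.card_sdiff_add_card_eq_card h1
      have h3 : (S (T+1) i).card = (Finset.univ.biUnion (S T)).card + (N (T+1) i).card := by
        rw [hstep (T+1) (by omega) i]
        exact Finset.card_union_of_disjoint (hNold (T+1) (by omega) i).symm
      omega
    have hsum := Finset.sum_congr (rfl : (Finset.univ : Finset (Fin m)) = Finset.univ)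
      (fun i _ => key i)
    rw [Finset.sum_add_distrib] at hsum
    simp only [Finset.sum_const, Finset.card_univ, Fintype.card_fin, smul_eq_mul] at hsum
    omega
end

section
/- Let X be a type with decidable equality, m ≥ 1, T ≥ 1, and let S : ℕ → Fin m → Finset X and N : ℕ → Fin m → Finset X satisfy: S 0 i = ∅ for all i; for all t ≥ 1 and all i, S t i = (⋃_{j} S (t−1) j) ∪ N t i, with |N t i| ≤ 1, N t i disjoint from ⋃_{j} S (t−1) j, and N t i pairwise disjoint across i. Write S̄ t = ⋃_{j} S t j, and let B_α, B_x ∈ ℕ. Then the cumulative communication of the continuous protocol satisfies ∑_{t=1}^{T} ∑_{i} ( |S t i|·B_α + |S̄ t|·B_α + |N t i|·B_x + |S̄ t \ S t i|·B_x ) ≤ 2·T·m·|S̄ T|·B_α + m·|S̄ T|·B_x. -/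
/-- Communication bound for the continuous protocol: the cumulative number of bytes
(coefficients to and from the coordinator plus support vectors transmitted at most
once each) is at most `2·T·m·|S̄ T|·B_α + m·|S̄ T|·B_x`. -/
theorem continuous_protocol_comm_bound {X : Type*} [DecidableEq X]
    (m T : ℕ) (hm : 1 ≤ m) (hT : 1 ≤ T) (Bα Bx : ℕ)
    (S N : ℕ → Fin m → Finset X)
    (hS0 : ∀ i : Fin m, S 0 i = ∅)
    (hstep : ∀ t, 1 ≤ t → ∀ i : Fin m,
      S t i = (Finset.univ.biUnion (S (t - 1))) ∪ N t i)
    (hNcard : ∀ t, 1 ≤ t → ∀ i : Fin m, (N t i).card ≤ 1)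
    (hNold : ∀ t, 1 ≤ t → ∀ i : Fin m,
      Disjoint (N t i) (Finset.univ.biUnion (S (t - 1))))
    (hNpair : ∀ t, 1 ≤ t → ∀ i j : Fin m, i ≠ j → Disjoint (N t i) (N t j)) :
    ∑ t ∈ Finset.Icc 1 T, ∑ i : Fin m,
        ((S t i).card * Bα + (Finset.univ.biUnion (S t)).card * Bα
          + (N t i).card * Bx + ((Finset.univ.biUnion (S t)) \ S t i).card * Bx) ≤
      2 * T * m * (Finset.univ.biUnion (S T)).card * Bα
        + m * (Finset.univ.biUnion (S T)).card * Bx := by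
  clear hT
  have hsub : ∀ t (i : Fin m), S t i ⊆ Finset.univ.biUnion (S t) := fun t i =>
    Finset.subset_biUnion_of_mem (S t) (Finset.mem_univ i)
  have key : ∀ t (i : Fin m), (N (t+1) i).card
      + ((Finset.univ.biUnion (S (t+1))) \ S (t+1) i).card
      + (Finset.univ.biUnion (S t)).card = (Finset.univ.biUnion (S (t+1))).card := by
    intro t i
    have h1 := Finset.card_sdiff_add_card_eq_card (hsub (t+1) i)
    have h2 : (S (t+1) i).card = (Finset.univ.biUnion (S t)).card + (N (t+1) i).card := by
      rw [hstep (t+1) (by omega) i]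
      exact Finset.card_union_of_disjoint (hNold (t+1) (by omega) i).symm
    omega
  induction T with
  | zero => simp
  | succ T ih =>
    rw [Finset.sum_Icc_succ_top (by omega)]
    have hk := key T
    have hc := fun i => Finset.card_le_card (hsub (T+1) i)
    generalize (Finset.univ.biUnion (S T)).card = a at *
    generalize hb : (Finset.univ.biUnion (S (T+1))).card = b at *
    have hab : a ≤ b := by
      have := hk ⟨0, hm⟩
      omega
    obtain ⟨d, rfl⟩ := Nat.exists_eq_add_of_le hab
    have hterm : ∑ i : Fin m, ((S (T+1) i).card * Bα + (a + d) * Bα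
          + (N (T+1) i).card * Bx + ((Finset.univ.biUnion (S (T+1))) \ S (T+1) i).card * Bx)
        ≤ ∑ i : Fin m, (2 * (a + d) * Bα + d * Bx) := by
      apply Finset.sum_le_sum
      intro i _
      have h1 : (N (T+1) i).card + ((Finset.univ.biUnion (S (T+1))) \ S (T+1) i).card = d := by
        have := hk i
        omega
      have h2 := Nat.mul_le_mul_right Bα (hc i)
      rw [← h1] at h2 ⊢
      linarith
    rw [Finset.sum_const, Finset.card_univ, Fintype.card_fin, smul_eq_mul] at hterm
    refine (Nat.add_le_add ih hterm).trans ?_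
    have : 0 ≤ 2 * T * m * d * Bα := Nat.zero_le _
    linarith
end
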